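/- Let H > 0 and 0 < ε' ≤ H, and let r, r' ∈ [0, H] with |r − r'| ≤ ε'. Then |ln((2H + r)/(2H + r'))| ≤ ln(1 + ε'/H) and |ln((2H − r)/(2H − r'))| ≤ ln(1 + ε'/H). Consequently, for any K ≥ 1 and any rewards r₁, …, r_K, r'₁, …, r'_K ∈ [0, H] with |r_k − r'_k| ≤ ε' for all k and ε' ≤ H/K, the cumulative log density ratio between the binarized reward observations satisfies sup over outcome sequences v ∈ {+2H, −2H}^K of |Σ_{k=1}^K ln( P[b(r_k) = v_k] / P[b(r'_k) = v_k] )| ≤ K·ln(1 + ε'/H) ≤ K·ε'/H ≤ 1. -/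

import Mathlib

/-- The probability that the unbiased binarization `b(r)` of the reward
`r ∈ [0, H]` takes the value `+2H` (when `v = true`) or `-2H` (when
`v = false`): `P[b(r) = +2H] = 1/2 + r/(4H)` and `P[b(r) = -2H] = 1/2 - r/(4H)`. -/
noncomputable def binProb (H r : ℝ) (v : Bool) : ℝ :=
  if v then (2 * H + r) / (4 * H) else (2 * H - r) / (4 * H)

/-- If `a, b ≥ c > 0` differ by at most `ε`, their log-ratio is at most `log (1 + ε / c)`. -/
theorem abs_log_div_le_log_one_add {a b c ε : ℝ} (hc : 0 < c) (ha : c ≤ a) (hb : c ≤ b)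
    (hab : |a - b| ≤ ε) : |Real.log (a / b)| ≤ Real.log (1 + ε / c) := by
  have key : ∀ x y : ℝ, c ≤ x → c ≤ y → x - y ≤ ε → 0 ≤ ε →
      Real.log (x / y) ≤ Real.log (1 + ε / c) := by
    intro x y hx hy hxy hε
    have hx0 : 0 < x := hc.trans_le hx
    have hy0 : 0 < y := hc.trans_le hy
    refine Real.log_le_log (by positivity) ?_
    calc x / y ≤ (y + ε) / y := by gcongr; linarith
      _ = 1 + ε / y := by field_simp
      _ ≤ 1 + ε / c := by gcongr
  have hε : 0 ≤ ε := (abs_nonneg _).trans hab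
  obtain ⟨h1, h2⟩ := abs_le.mp hab
  refine abs_le'.mpr ⟨key a b ha hb h2 hε, ?_⟩
  rw [← Real.log_inv, inv_div]
  exact key b a hb ha (by linarith) hε

/-- Core of the robustness-by-binarization argument: perturbing a reward in
`[0, H]` by at most `ε'` changes each log-likelihood of the binarized
observation by at most `ln(1 + ε'/H)`, hence the cumulative log density ratio
over `K` episodes is at most `K·ln(1 + ε'/H) ≤ K·ε'/H ≤ 1` when `ε' ≤ H/K`. -/
theorem stmt11 (H ε' : ℝ) (hH : 0 < H) (hε : 0 < ε') (hεH : ε' ≤ H) :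
    (∀ r r' : ℝ, r ∈ Set.Icc 0 H → r' ∈ Set.Icc 0 H → |r - r'| ≤ ε' →
      |Real.log ((2 * H + r) / (2 * H + r'))| ≤ Real.log (1 + ε' / H) ∧
      |Real.log ((2 * H - r) / (2 * H - r'))| ≤ Real.log (1 + ε' / H)) ∧
    (∀ K : ℕ, 1 ≤ K → ε' ≤ H / K →
      ∀ r r' : Fin K → ℝ,
        (∀ k, r k ∈ Set.Icc 0 H) → (∀ k, r' k ∈ Set.Icc 0 H) →
        (∀ k, |r k - r' k| ≤ ε') →
        ∀ v : Fin K → Bool,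
          |∑ k, Real.log (binProb H (r k) (v k) / binProb H (r' k) (v k))|
            ≤ K * Real.log (1 + ε' / H) ∧
          (K : ℝ) * Real.log (1 + ε' / H) ≤ K * (ε' / H) ∧
          (K : ℝ) * (ε' / H) ≤ 1) := by
  have step : ∀ r r' : ℝ, r ∈ Set.Icc 0 H → r' ∈ Set.Icc 0 H → |r - r'| ≤ ε' →
      |Real.log ((2 * H + r) / (2 * H + r'))| ≤ Real.log (1 + ε' / H) ∧
      |Real.log ((2 * H - r) / (2 * H - r'))| ≤ Real.log (1 + ε' / H) := by
    rintro r r' ⟨hr0, hrH⟩ ⟨hr0', hrH'⟩ h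
    refine ⟨abs_log_div_le_log_one_add hH (by linarith) (by linarith) ?_,
      abs_log_div_le_log_one_add hH (by linarith) (by linarith) ?_⟩
    · rwa [add_sub_add_left_eq_sub]
    · rwa [sub_sub_sub_cancel_left, abs_sub_comm]
  refine ⟨step, fun K hK hεK r r' hr hr' h v => ⟨?_, ?_, ?_⟩⟩
  · calc |∑ k, Real.log (binProb H (r k) (v k) / binProb H (r' k) (v k))|
        ≤ ∑ k, |Real.log (binProb H (r k) (v k) / binProb H (r' k) (v k))| :=
          Finset.abs_sum_le_sum_abs _ _
      _ ≤ ∑ _k : Fin K, Real.log (1 + ε' / H) := by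
          refine Finset.sum_le_sum fun k _ => ?_
          have h4 : 4 * H ≠ 0 := by positivity
          have hk := step (r k) (r' k) (hr k) (hr' k) (h k)
          cases v k
          · simpa [binProb, div_div_div_cancel_right₀ h4] using hk.2
          · simpa [binProb, div_div_div_cancel_right₀ h4] using hk.1
      _ = K * Real.log (1 + ε' / H) := by simp
  · have hlog := Real.log_le_sub_one_of_pos (show 0 < 1 + ε' / H by positivity)
    gcongr
    linarith
  · have hK0 : (0 : ℝ) < K := by exact_mod_cast hK
    rw [le_div_iff₀ hK0] at hεK
    rw [← mul_div_assoc, div_le_one hH]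
    linarith
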